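/- arXiv:1602.06226 — 2 statements merged into one kernel-verified Lean document; each statement's English description precedes it below -/
import Mathlib

section
/- Let K be a field, V a finite-dimensional K-vector space of dimension g, and let 1 ≤ k ≤ g. Suppose ψ : ⋀^k V → ⋀^k V is a K-linear endomorphism such that for every vector v ∈ V the subspace v ∧ ⋀^{k-1} V = { v ∧ ω : ω ∈ ⋀^{k-1} V } of ⋀^k V is mapped by ψ into itself. Then there exists a scalar c ∈ K such that ψ = c · id on ⋀^k V. -/
open Set.powersetCard Module in
/-- Coordinates of a vector of `v ∧ ⋀ⁿ V` along basis elements not involving `v`. -/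
theorem exteriorPower.ιMultiDual_eq_zero_of_eq_ι_mul
    {R M I : Type*} [CommRing R] [AddCommGroup M] [Module R M] [LinearOrder I]
    {n : ℕ} (b : Basis I R M) {i : I} {s : Set.powersetCard I (n + 1)} (hi : i ∉ s)
    {x : ⋀[R]^(n + 1) M} {ω : ⋀[R]^n M}
    (hx : (x : ExteriorAlgebra R M) = ExteriorAlgebra.ι R (b i) * ω) :
    ιMultiDual R (n + 1) b s x = 0 := by
  have key : ∀ ω ∈ ⋀[R]^n M, ∃ y : ⋀[R]^(n + 1) M,
      (y : ExteriorAlgebra R M) = ExteriorAlgebra.ι R (b i) * ω ∧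
        ιMultiDual R (n + 1) b s y = 0 := by
    intro ω hω
    rw [← ExteriorAlgebra.ιMulti_span_fixedDegree] at hω
    induction hω using Submodule.span_induction with
    | mem ω hω =>
      obtain ⟨m, rfl⟩ := hω
      refine ⟨ιMulti R (n + 1) (Matrix.vecCons (b i) m), ?_, ?_⟩
      · simp [ExteriorAlgebra.ιMulti_succ_apply]
      · rw [ιMultiDual_apply_ιMulti]
        refine Matrix.det_eq_zero_of_row_eq_zero 0 fun j => ?_
        have hne : ofFinEmbEquiv.symm s j ≠ i := fun h =>
          hi ((mem_range_ofFinEmbEquiv_symm_iff_mem s i).mp ⟨j, h⟩)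
        simp [hne.symm]
    | zero => exact ⟨0, by simp, by simp⟩
    | add ω₁ ω₂ _ _ h₁ h₂ =>
      obtain ⟨y₁, hy₁, hz₁⟩ := h₁
      obtain ⟨y₂, hy₂, hz₂⟩ := h₂
      exact ⟨y₁ + y₂, by simp [hy₁, hy₂, mul_add], by simp [hz₁, hz₂]⟩
    | smul a ω _ h =>
      obtain ⟨y, hy, hz⟩ := h
      exact ⟨a • y, by simp [hy], by simp [hz]⟩
  obtain ⟨y, hy, hz⟩ := key ω ω.2
  rwa [Subtype.ext (hx.trans hy.symm)]

/-- A decomposable vector `v₀ ∧ ⋯ ∧ vₙ` is divisible by each of its factors. -/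
theorem exteriorPower.exists_ιMulti_eq_ι_mul
    {R M : Type*} [CommRing R] [AddCommGroup M] [Module R M] {n : ℕ}
    (v : Fin (n + 1) → M) (i : Fin (n + 1)) :
    ∃ ω : ⋀[R]^n M,
      (ιMulti R (n + 1) v : ExteriorAlgebra R M) = ExteriorAlgebra.ι R (v i) * ω := by
  let σ := Equiv.swap 0 i
  refine ⟨Equiv.Perm.sign σ • ιMulti R n (Matrix.vecTail (v ∘ σ)), ?_⟩
  have h := (ExteriorAlgebra.ιMulti R (n + 1)).map_perm (v ∘ σ) σ
  have hσ : (v ∘ σ) ∘ σ = v := by ext j; simp [σ]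
  rw [hσ] at h
  rw [ιMulti_apply_coe, h, ExteriorAlgebra.ιMulti_succ_apply]
  have hσ0 : (v ∘ σ) 0 = v i := by simp [σ]
  rw [hσ0]
  rcases Int.units_eq_one_or (Equiv.Perm.sign σ) with hs | hs <;> simp [hs]

open Module in
/-- A vector divisible by every `b i` with `i ∈ s` is a multiple of the basis vector of the
exterior power indexed by `s`. -/
theorem exteriorPower.eq_smul_basis_of_forall_eq_ι_mul
    {R M I : Type*} [CommRing R] [AddCommGroup M] [Module R M] [LinearOrder I]
    {n : ℕ} (b : Basis I R M) (s : Set.powersetCard I (n + 1)) (x : ⋀[R]^(n + 1) M)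
    (hx : ∀ i ∈ s, ∃ ω : ⋀[R]^n M,
      (x : ExteriorAlgebra R M) = ExteriorAlgebra.ι R (b i) * ω) :
    x = (b.exteriorPower (n + 1)).repr x s • b.exteriorPower (n + 1) s := by
  apply (b.exteriorPower (n + 1)).repr.injective
  ext t
  by_cases hst : s = t
  · simp [hst]
  · obtain ⟨i, his, hit⟩ := (Set.powersetCard.exists_mem_notMem_iff_ne s t).mp hst
    obtain ⟨ω, hω⟩ := hx i his
    rw [basis_repr_apply, ιMultiDual_eq_zero_of_eq_ι_mul b hit hω]
    simp [hst]

open Module in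
/-- A vector divisible by every factor of a nonzero decomposable vector is a multiple of it. -/
theorem exteriorPower.exists_eq_smul_ιMulti_of_forall_eq_ι_mul
    {K V : Type*} [Field K] [AddCommGroup V] [Module K V] {n : ℕ}
    {v : Fin (n + 1) → V} (hv : ιMulti K (n + 1) v ≠ 0) (x : ⋀[K]^(n + 1) V)
    (hx : ∀ i, ∃ ω : ⋀[K]^n V,
      (x : ExteriorAlgebra K V) = ExteriorAlgebra.ι K (v i) * ω) :
    ∃ c : K, x = c • ιMulti K (n + 1) v := by
  classical
  have hli : LinearIndependent K v := by
    by_contra h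
    exact hv ((ιMulti K (n + 1)).map_linearDependent v h)
  let b := Basis.extend hli.linearIndepOn_id
  let : LinearOrder (hli.linearIndepOn_id.extend (Set.subset_univ _)) :=
    linearOrderOfSTO WellOrderingRel
  let e : Fin (n + 1) ↪ hli.linearIndepOn_id.extend (Set.subset_univ _) :=
    ⟨fun i => ⟨v i, Basis.subset_extend hli.linearIndepOn_id ⟨i, rfl⟩⟩,
      fun i j h => hli.injective (congrArg Subtype.val h)⟩
  have hb : ∀ i, b (e i) = v i := fun i => Basis.extend_apply_self _ _
  let s := Set.powersetCard.ofFinEmb (n + 1) _ e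
  have hs : ∀ y : ⋀[K]^(n + 1) V, (∀ i, ∃ ω : ⋀[K]^n V,
      (y : ExteriorAlgebra K V) = ExteriorAlgebra.ι K (v i) * ω) →
      ∃ c : K, y = c • b.exteriorPower (n + 1) s := by
    intro y hy
    refine ⟨_, eq_smul_basis_of_forall_eq_ι_mul b s y fun i hi => ?_⟩
    obtain ⟨j, rfl⟩ := (Set.powersetCard.mem_ofFinEmb_iff_mem_range _ _ e i).mp hi
    rw [hb]
    exact hy j
  obtain ⟨c, hc⟩ := hs x hx
  obtain ⟨d, hd⟩ := hs _ (exists_ιMulti_eq_ι_mul v)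
  have hd0 : d ≠ 0 := by
    rintro rfl
    exact hv (by rw [hd, zero_smul])
  exact ⟨c / d, by rw [hd, smul_smul, div_mul_cancel₀ c hd0, hc]⟩

open Module Set.powersetCard in
/-- A coordinate of a decomposable vector is nonzero if the corresponding minor is a permutation
matrix. -/
theorem exteriorPower.ιMultiDual_ιMulti_ne_zero
    {R M I : Type*} [CommRing R] [Nontrivial R] [AddCommGroup M] [Module R M] [LinearOrder I]
    {n : ℕ} (b : Basis I R M) (s : Set.powersetCard I n) (e : Fin n ≃ s.val)
    (v : Fin n → M) (hv : ∀ j, ∀ i ∈ s, b.repr (v j) i = if (e j : I) = i then 1 else 0) :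
    ιMultiDual R n b s (ιMulti R n v) ≠ 0 := by
  let σ : Equiv.Perm (Fin n) := e.trans (orderIsoOfFin s).toEquiv.symm
  have hσ : (Matrix.of fun i j => b.coord (ofFinEmbEquiv.symm s j) (v i)) = σ.permMatrix R := by
    ext i j
    rw [Matrix.of_apply, Basis.coord_apply,
      hv i _ ((mem_range_ofFinEmbEquiv_symm_iff_mem s _).mp ⟨j, rfl⟩),
      Equiv.Perm.permMatrix, PEquiv.toMatrix_apply]
    have : (e i : I) = ofFinEmbEquiv.symm s j ↔ σ i = j := by
      rw [Equiv.trans_apply, Equiv.symm_apply_eq, Subtype.ext_iff]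
      rfl
    simp [this, eq_comm]
  rw [ιMultiDual_apply_ιMulti, hσ, Matrix.det_permutation]
  exact ((Equiv.Perm.sign σ).map (Int.castRingHom R).toMonoidHom).ne_zero

open Module Set.powersetCard in
/-- Any two coordinates with respect to the basis of an exterior power are simultaneously nonzero
on some decomposable vector. -/
theorem exteriorPower.exists_ιMultiDual_ιMulti_ne_zero
    {R M I : Type*} [CommRing R] [Nontrivial R] [AddCommGroup M] [Module R M] [LinearOrder I]
    {n : ℕ} (b : Basis I R M) (s t : Set.powersetCard I n) :
    ∃ v : Fin n → M, ιMultiDual R n b s (ιMulti R n v) ≠ 0 ∧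
      ιMultiDual R n b t (ιMulti R n v) ≠ 0 := by
  let e := (orderIsoOfFin s).toEquiv
  have he : Function.Injective fun j => (e j : I) := Subtype.val_injective.comp e.injective
  obtain ⟨f, hf⟩ := Set.MapsTo.exists_equiv_extend_of_card_eq (t := t.val)
    (s := {j | (e j : I) ∈ t.val}) (f := fun j => (e j : I))
    ((Fintype.card_fin n).trans t.prop.symm) (fun _ h => h) he.injOn
  have hfs : ∀ j, (e j : I) ∉ t.val → (f j : I) ∉ s.val := by
    intro j hj hs
    obtain ⟨l, hl⟩ := e.surjective ⟨f j, hs⟩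
    have hl' : (e l : I) = f j := congrArg Subtype.val hl
    have hlt : (e l : I) ∈ t.val := hl' ▸ (f j).2
    have hfl : f l = f j := Subtype.ext ((hf l hlt).trans hl')
    exact hj (f.injective hfl ▸ hlt)
  refine ⟨fun j => if (e j : I) ∈ t.val then b (e j) else b (e j) + b (f j),
    ιMultiDual_ιMulti_ne_zero b s e _ fun j i hi => ?_,
    ιMultiDual_ιMulti_ne_zero b t f _ fun j i hi => ?_⟩
  · split_ifs with hj h h
    · simp [h]
    · simp [h]
    · have : (f j : I) ≠ i := fun hfi => hfs j hj (hfi ▸ hi)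
      simp [h, this]
    · have : (f j : I) ≠ i := fun hfi => hfs j hj (hfi ▸ hi)
      simp [h, this]
  · by_cases hj : (e j : I) ∈ t.val
    · rw [if_pos hj, hf j hj]
      simp [Finsupp.single_apply]
    · have : (e j : I) ≠ i := fun hei => hj (hei ▸ hi)
      rw [if_neg hj]
      simp [Finsupp.single_apply, this]

open Module in
/-- An endomorphism of an exterior power for which every decomposable vector is an eigenvector is
a scalar. -/
theorem exteriorPower.exists_eq_smul_id_of_forall_ιMulti
    {R M : Type*} [CommRing R] [IsDomain R] [AddCommGroup M] [Module R M] [Module.Free R M]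
    {n : ℕ} (ψ : ⋀[R]^n M →ₗ[R] ⋀[R]^n M)
    (hψ : ∀ v : Fin n → M, ∃ c : R, ψ (ιMulti R n v) = c • ιMulti R n v) :
    ∃ c : R, ψ = c • LinearMap.id := by
  classical
  let b := Module.Free.chooseBasis R M
  let : LinearOrder (Module.Free.ChooseBasisIndex R M) := linearOrderOfSTO WellOrderingRel
  let B := b.exteriorPower n
  have hB : ∀ s, ∃ c : R, ψ (B s) = c • B s := by
    intro s
    rw [basis_apply]
    exact hψ _
  choose c hc using hB
  have hcoord : ∀ s, ιMultiDual R n b s ∘ₗ ψ = c s • ιMultiDual R n b s := by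
    intro s
    refine B.ext fun t => ?_
    rw [LinearMap.comp_apply, hc, map_smul, LinearMap.smul_apply, basis_apply]
    by_cases hst : s = t
    · rw [hst]
    · rw [ιMultiDual_apply_nondiag R n b s t hst, smul_zero, smul_zero]
  have hcc : ∀ s t, c s = c t := by
    intro s t
    obtain ⟨v, hs, ht⟩ := exists_ιMultiDual_ιMulti_ne_zero b s t
    obtain ⟨d, hd⟩ := hψ v
    have key : ∀ u, ιMultiDual R n b u (ιMulti R n v) ≠ 0 → c u = d := by
      intro u hu
      have h := LinearMap.congr_fun (hcoord u) (ιMulti R n v)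
      rw [LinearMap.comp_apply, hd, map_smul, LinearMap.smul_apply, smul_eq_mul,
        smul_eq_mul] at h
      exact (mul_right_cancel₀ hu h).symm
    rw [key s hs, key t ht]
  rcases isEmpty_or_nonempty (Set.powersetCard (Module.Free.ChooseBasisIndex R M) n) with
    hE | ⟨⟨s⟩⟩
  · exact ⟨0, B.ext fun t => hE.elim t⟩
  · exact ⟨c s, B.ext fun t => by simp [hc, hcc s t]⟩

/-- Let `V` be a `g`-dimensional vector space over a field `K` and `1 ≤ k ≤ g`.
If a linear endomorphism `ψ` of the `k`-th exterior power `⋀^k V` maps each subspace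
`v ∧ ⋀^(k-1) V` (for every `v ∈ V`) into itself, then `ψ` is a scalar multiple of the
identity. -/
theorem exteriorPower_endomorphism_preserving_wedge_subspaces_is_scalar
    {K V : Type*} [Field K] [AddCommGroup V] [Module K V] [FiniteDimensional K V]
    (g k : ℕ) (hV : Module.finrank K V = g) (hk1 : 1 ≤ k) (hkg : k ≤ g)
    (ψ : ⋀[K]^k V →ₗ[K] ⋀[K]^k V)
    (hψ : ∀ v : V, ∀ x : ⋀[K]^k V,
      (∃ ω : ⋀[K]^(k-1) V, (x : ExteriorAlgebra K V) = ExteriorAlgebra.ι K v * ω) →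
      ∃ ω' : ⋀[K]^(k-1) V, ((ψ x : ⋀[K]^k V) : ExteriorAlgebra K V)
        = ExteriorAlgebra.ι K v * ω') :
    ∃ c : K, ψ = c • LinearMap.id := by
  obtain ⟨n, rfl⟩ : ∃ n, k = n + 1 := ⟨k - 1, by omega⟩
  refine exteriorPower.exists_eq_smul_id_of_forall_ιMulti ψ fun v => ?_
  by_cases hv : exteriorPower.ιMulti K (n + 1) v = 0
  · exact ⟨0, by simp [hv]⟩
  · exact exteriorPower.exists_eq_smul_ιMulti_of_forall_eq_ι_mul hv _ fun i =>
      hψ (v i) _ (exteriorPower.exists_ιMulti_eq_ι_mul v i)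
end

section
/- Let K be a field, V a finite-dimensional K-vector space of dimension n, and let φ be a nonzero linear functional on V. Denote by ι_φ the contraction (interior product) with φ on the exterior algebra of V, i.e., the unique graded antiderivation extending φ : V → K. If x ∈ ⋀^p V and y ∈ ⋀^q V satisfy p + q = n, ι_φ(x) = 0 and ι_φ(y) = 0, then x ∧ y = 0 in ⋀^n V. (In particular, for nonzero φ the contraction ι_φ : ⋀^n V → ⋀^{n-1} V is injective.) -/
/-- The exterior powers of a vector space vanish in degrees above its dimension. -/
theorem ExteriorAlgebra.eq_zero_of_mem_exteriorPower_of_finrank_lt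
    {K V : Type*} [Field K] [AddCommGroup V] [Module K V] [FiniteDimensional K V]
    {m : ℕ} (hm : Module.finrank K V < m) {w : ExteriorAlgebra K V} (hw : w ∈ ⋀[K]^m V) :
    w = 0 := by
  have hbot : ⋀[K]^m V = ⊥ := Submodule.finrank_eq_zero.mp <| by
    rw [exteriorPower.finrank_eq, Nat.choose_eq_zero_of_lt hm]
  rwa [hbot, Submodule.mem_bot] at hw

/-- Let `V` be an `n`-dimensional vector space over a field `K` and `φ` a
nonzero linear functional on `V`. Let `c = ι_φ` be the contraction with `φ` on the exterior
algebra of `V`, i.e. the graded antiderivation extending `φ`. If `x ∈ ⋀^p V` and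
`y ∈ ⋀^q V` with `p + q = n` satisfy `ι_φ x = 0` and `ι_φ y = 0`, then `x ∧ y = 0` in
`⋀^n V`; in particular `ι_φ` is injective on the top exterior power `⋀^n V`. -/
theorem wedge_eq_zero_of_contractions_eq_zero
    {K V : Type*} [Field K] [AddCommGroup V] [Module K V] [FiniteDimensional K V]
    (n : ℕ) (hn : Module.finrank K V = n)
    (φ : V →ₗ[K] K) (hφ : φ ≠ 0)
    (c : ExteriorAlgebra K V →ₗ[K] ExteriorAlgebra K V)
    (hc1 : ∀ v : V, c (ExteriorAlgebra.ι K v) = algebraMap K (ExteriorAlgebra K V) (φ v))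
    (hc2 : ∀ (p : ℕ) (x y : ExteriorAlgebra K V), x ∈ ⋀[K]^p V →
      c (x * y) = c x * y + ((-1 : K) ^ p) • (x * c y))
    (p q : ℕ) (hpq : p + q = n)
    (x y : ExteriorAlgebra K V) (hx : x ∈ ⋀[K]^p V) (hy : y ∈ ⋀[K]^q V)
    (hcx : c x = 0) (hcy : c y = 0) :
    x * y = 0 ∧ (∀ z ∈ ⋀[K]^n V, c z = 0 → z = 0) := by
  have ι_mem (v : V) : ExteriorAlgebra.ι K v ∈ ⋀[K]^1 V := by
    rw [ExteriorAlgebra.exteriorPower, pow_one]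
    exact LinearMap.mem_range_self _ v
  have injOn_top (z : ExteriorAlgebra K V) (hz : z ∈ ⋀[K]^n V) (hcz : c z = 0) : z = 0 := by
    obtain ⟨v, hv⟩ := LinearMap.surjective hφ 1
    have hmem : ExteriorAlgebra.ι K v * z ∈ ⋀[K]^(1 + n) V :=
      SetLike.mul_mem_graded (ι_mem v) hz
    have hzero : ExteriorAlgebra.ι K v * z = 0 :=
      ExteriorAlgebra.eq_zero_of_mem_exteriorPower_of_finrank_lt (by lia) hmem
    simpa [hzero, hc1, hv, hcz] using (hc2 1 _ z (ι_mem v)).symm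
  refine ⟨injOn_top _ (hpq ▸ SetLike.mul_mem_graded hx hy) ?_, injOn_top⟩
  rw [hc2 p x y hx, hcx, hcy, zero_mul, mul_zero, smul_zero, add_zero]
end
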